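/- Let r ≥ 1 and let n_1, ..., n_r be integers with 1 < n_1 | n_2 | ... | n_r, let G = C_{n_1} ⊕ ... ⊕ C_{n_r} and n = exp(G) = n_r. Let S be a zero-sumfree sequence over G with k(S) = k(G) whose length is minimal among all zero-sumfree sequences S' over G with k(S') = k(G). For each positive divisor d of n set x_d = |S_d|. Then: (a) for every divisor d of n and every divisor d' of d with d' > 1, x_d ≤ η(G_{υ(d',d)}) − 1; (b) for every divisor d of n, Σ_{d' | d} x_{d'} ≤ D(G_{υ(d,d)}) − 1; and (c) Σ_{d | n} x_d/d ≥ k*(G). -/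

import Mathlib

open scoped BigOperators

attribute [local instance] Classical.propDecidable

/-- A sequence (multiset) over `G` is zero-sumfree if no nonempty sub-multiset sums to `0`. -/
def IsZeroSumFree {G : Type*} [AddCommGroup G] (S : Multiset G) : Prop :=
  ∀ T : Multiset G, T ≤ S → T ≠ 0 → T.sum ≠ 0

/-- A minimal zero-sum sequence: sum `0`, and no nonempty proper sub-multiset sums to `0`. -/
def IsMinimalZeroSum {G : Type*} [AddCommGroup G] (S : Multiset G) : Prop :=
  S.sum = 0 ∧ ∀ T : Multiset G, T < S → T ≠ 0 → T.sum ≠ 0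

/-- The cross number of a sequence: `k(S) = Σ_{g ∈ S} 1/ord(g)`. -/
noncomputable def crossNumber {G : Type*} [AddCommGroup G] (S : Multiset G) : ℝ :=
  (S.map fun g => (1 : ℝ) / (addOrderOf g)).sum

/-- The little cross number `k(G)`: max of `k(S)` over zero-sumfree sequences `S` over `G`. -/
noncomputable def littleCrossNumber (G : Type*) [AddCommGroup G] : ℝ :=
  sSup {x : ℝ | ∃ S : Multiset G, IsZeroSumFree S ∧ crossNumber S = x}

/-- The cross number `K(G)`: max of `k(S)` over minimal zero-sum sequences `S` over `G`. -/
noncomputable def bigCrossNumber (G : Type*) [AddCommGroup G] : ℝ :=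
  sSup {x : ℝ | ∃ S : Multiset G, IsMinimalZeroSum S ∧ crossNumber S = x}

/-- The Davenport constant `D(G)`. -/
noncomputable def davenport (G : Type*) [AddCommGroup G] : ℕ :=
  sInf {t | 1 ≤ t ∧ ∀ S : Multiset G, t ≤ Multiset.card S →
    ∃ T, T ≤ S ∧ T ≠ 0 ∧ T.sum = 0}

/-- The constant `η(G)`. -/
noncomputable def etaConst (G : Type*) [AddCommGroup G] : ℕ :=
  sInf {t | 1 ≤ t ∧ ∀ S : Multiset G, t ≤ Multiset.card S →
    ∃ T, T ≤ S ∧ T ≠ 0 ∧ Multiset.card T ≤ AddMonoid.exponent G ∧ T.sum = 0}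

/-- `υ_i(d',d) = A_i / gcd(A_i, B_i)` where `A_i = gcd(d', n_i)` and
`B_i = lcm(d, n_i)/lcm(d', n_i)`. -/
def upsilon (ni d' d : ℕ) : ℕ :=
  Nat.gcd d' ni / Nat.gcd (Nat.gcd d' ni) (Nat.lcm d ni / Nat.lcm d' ni)

/-- `k*` of `C_{n_1} ⊕ ... ⊕ C_{n_r}`, computed from the primary decomposition. -/
noncomputable def kStarTuple {r : ℕ} (n : Fin r → ℕ) : ℝ :=
  ∑ i, ∑ p ∈ (n i).primeFactors,
    ((p ^ ((n i).factorization p) : ℝ) - 1) / (p ^ ((n i).factorization p))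

/-- `α(n) = Σ_{d | n} (P⁻(d) − 1)/d`. -/
noncomputable def alphaFn (n : ℕ) : ℝ :=
  ∑ d ∈ n.divisors, ((d.minFac : ℝ) - 1) / d

/-- `β(n) = Σ_{p | n prime} (p − 1)/p`. -/
noncomputable def betaFn (n : ℕ) : ℝ :=
  ∑ p ∈ n.primeFactors, ((p : ℝ) - 1) / p

namespace IsZeroSumFree

variable {G : Type*} [AddCommGroup G]

/-- Replacing a nonempty subsequence by its sum preserves zero-sumfreeness. -/
theorem sum_cons_sub {S T : Multiset G} (hS : IsZeroSumFree S) (hT : T ≤ S) (hT0 : T ≠ 0) :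
    IsZeroSumFree (T.sum ::ₘ (S - T)) := by
  intro U hU hU0
  by_cases hmem : T.sum ∈ U
  · obtain ⟨V, rfl⟩ := Multiset.exists_cons_of_mem hmem
    have hV : V ≤ S - T := (Multiset.cons_le_cons_iff _).1 hU
    have hTV : T + V ≤ S := by
      calc T + V ≤ T + (S - T) := by gcongr
        _ = S := add_tsub_cancel_of_le hT
    have := hS (T + V) hTV (by
      intro h
      exact hT0 (Multiset.le_zero.1 (h ▸ Multiset.le_add_right T V)))
    simpa using this
  · exact hS U (((Multiset.le_cons_of_notMem hmem).1 hU).trans tsub_le_self) hU0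

end IsZeroSumFree

section Finite

variable {G : Type*} [AddCommGroup G] [Finite G]

/-- A long sequence over a finite group repeats some element `exp(G)` times. -/
theorem exists_short_zero_sum (S : Multiset G)
    (h : Nat.card G * AddMonoid.exponent G ≤ Multiset.card S) :
    ∃ T, T ≤ S ∧ T ≠ 0 ∧ Multiset.card T ≤ AddMonoid.exponent G ∧ T.sum = 0 := by
  have := Fintype.ofFinite G
  have he : 0 < AddMonoid.exponent G :=
    Nat.pos_of_ne_zero AddMonoid.exponent_ne_zero_of_finite
  obtain ⟨g, hg⟩ : ∃ g, AddMonoid.exponent G ≤ S.count g := by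
    by_contra! hlt
    have hsum : ∑ a : G, S.count a = Multiset.card S :=
      Multiset.sum_count_eq_card fun a _ => Finset.mem_univ a
    have hlt' : ∑ a : G, S.count a < ∑ _a : G, AddMonoid.exponent G :=
      Finset.sum_lt_sum_of_nonempty Finset.univ_nonempty fun a _ => hlt a
    simp only [Finset.sum_const, Finset.card_univ, smul_eq_mul] at hlt'
    rw [Nat.card_eq_fintype_card] at h
    omega
  refine ⟨Multiset.replicate (AddMonoid.exponent G) g, Multiset.le_count_iff_replicate_le.1 hg,
    ?_, by simp, by simp [AddMonoid.exponent_nsmul_eq_zero]⟩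
  intro h0
  have := congrArg Multiset.card h0
  simp only [Multiset.card_replicate, Multiset.card_zero] at this
  omega

theorem exists_zero_sum_of_davenport_le (S : Multiset G) (h : davenport G ≤ Multiset.card S) :
    ∃ T, T ≤ S ∧ T ≠ 0 ∧ T.sum = 0 := by
  refine (Nat.sInf_mem (s := {t | 1 ≤ t ∧ ∀ S : Multiset G, t ≤ Multiset.card S →
    ∃ T, T ≤ S ∧ T ≠ 0 ∧ T.sum = 0}) ⟨Nat.card G * AddMonoid.exponent G, ?_, ?_⟩).2 S h
  · exact Nat.mul_pos Nat.card_pos (Nat.pos_of_ne_zero AddMonoid.exponent_ne_zero_of_finite)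
  · intro S hS
    obtain ⟨T, h1, h2, -, h3⟩ := exists_short_zero_sum S hS
    exact ⟨T, h1, h2, h3⟩

theorem exists_short_zero_sum_of_etaConst_le (S : Multiset G)
    (h : etaConst G ≤ Multiset.card S) :
    ∃ T, T ≤ S ∧ T ≠ 0 ∧ Multiset.card T ≤ AddMonoid.exponent G ∧ T.sum = 0 :=
  (Nat.sInf_mem (s := {t | 1 ≤ t ∧ ∀ S : Multiset G, t ≤ Multiset.card S →
    ∃ T, T ≤ S ∧ T ≠ 0 ∧ Multiset.card T ≤ AddMonoid.exponent G ∧ T.sum = 0})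
    ⟨Nat.card G * AddMonoid.exponent G,
      Nat.mul_pos Nat.card_pos (Nat.pos_of_ne_zero AddMonoid.exponent_ne_zero_of_finite),
      exists_short_zero_sum⟩).2 S h

theorem crossNumber_le_card (S : Multiset G) : crossNumber S ≤ Multiset.card S := by
  induction S using Multiset.induction_on with
  | empty => simp [crossNumber]
  | cons a S ih =>
    have h1 : (1 : ℝ) / (addOrderOf a) ≤ 1 := by
      rw [div_le_one (by exact_mod_cast addOrderOf_pos a)]
      exact_mod_cast addOrderOf_pos a
    simp only [crossNumber, Multiset.map_cons, Multiset.sum_cons, Multiset.card_cons] at ih ⊢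
    push_cast
    linarith

theorem IsZeroSumFree.crossNumber_le {S : Multiset G} (hS : IsZeroSumFree S) :
    crossNumber S ≤ littleCrossNumber G := by
  refine le_csSup ⟨davenport G, ?_⟩ ⟨S, hS, rfl⟩
  rintro _ ⟨T, hT, rfl⟩
  refine (crossNumber_le_card T).trans (Nat.cast_le.2 ?_)
  by_contra! hlt
  obtain ⟨U, hU, hU0, hsum⟩ := exists_zero_sum_of_davenport_le T hlt.le
  exact hT U hU hU0 hsum

end Finite

theorem crossNumber_eq_sum_divisors {G : Type*} [AddCommGroup G] {N : ℕ} (hN : N ≠ 0)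
    (hexp : ∀ g : G, addOrderOf g ∣ N) (S : Multiset G) :
    crossNumber S =
      ∑ d ∈ N.divisors, (Multiset.card (S.filter fun g => addOrderOf g = d) : ℝ) / d := by
  induction S using Multiset.induction_on with
  | empty => simp [crossNumber]
  | cons a S ih =>
    have key : ∀ d : ℕ, (Multiset.card ((a ::ₘ S).filter fun g => addOrderOf g = d) : ℝ) / d =
        (if addOrderOf a = d then (1 : ℝ) / d else 0) +
          (Multiset.card (S.filter fun g => addOrderOf g = d) : ℝ) / d := by
      intro d
      by_cases h : addOrderOf a = d
      · rw [Multiset.filter_cons_of_pos (p := fun g => addOrderOf g = d) S h, if_pos h,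
          Multiset.card_cons]
        push_cast
        ring
      · rw [Multiset.filter_cons_of_neg (p := fun g => addOrderOf g = d) S h, if_neg h, zero_add]
    simp only [key, Finset.sum_add_distrib, ← ih]
    rw [Finset.sum_ite_eq, if_pos (Nat.mem_divisors.2 ⟨hexp a, hN⟩)]
    simp [crossNumber]

theorem sum_card_filter_addOrderOf {G : Type*} [AddCommGroup G] {d : ℕ} (hd : d ≠ 0)
    [DecidablePred fun g : G => d • g = 0] (S : Multiset G) :
    ∑ d' ∈ d.divisors, Multiset.card (S.filter fun g => addOrderOf g = d') =
      Multiset.card (S.filter fun g => d • g = 0) := by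
  induction S using Multiset.induction_on with
  | empty => simp
  | cons a S ih =>
    have key : ∀ e : ℕ, Multiset.card ((a ::ₘ S).filter fun g => addOrderOf g = e) =
        (if addOrderOf a = e then 1 else 0) +
          Multiset.card (S.filter fun g => addOrderOf g = e) := by
      intro e
      by_cases h : addOrderOf a = e
      · rw [Multiset.filter_cons_of_pos (p := fun g => addOrderOf g = e) S h, if_pos h,
          Multiset.card_cons, add_comm]
      · rw [Multiset.filter_cons_of_neg (p := fun g => addOrderOf g = e) S h, if_neg h, zero_add]
    simp only [key, Finset.sum_add_distrib, ih]
    rw [Finset.sum_ite_eq]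
    by_cases h : d • a = 0
    · rw [Multiset.filter_cons_of_pos (p := fun g => d • g = 0) S h,
        if_pos (Nat.mem_divisors.2 ⟨addOrderOf_dvd_of_nsmul_eq_zero h, hd⟩), Multiset.card_cons,
        add_comm]
    · rw [Multiset.filter_cons_of_neg (p := fun g => d • g = 0) S h,
        if_neg fun h' => h (addOrderOf_dvd_iff_nsmul_eq_zero.1 (Nat.dvd_of_mem_divisors h')),
        zero_add]

theorem upsilon_dvd_gcd (n d' d : ℕ) : upsilon n d' d ∣ Nat.gcd d' n :=
  Nat.div_dvd_of_dvd (Nat.gcd_dvd_left _ _)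

theorem gcd_dvd_upsilon_mul {n d' m : ℕ} (hn : 0 < n) (hd' : 0 < d') :
    Nat.gcd (m * d') n ∣ upsilon n d' (m * d') * m := by
  set A := Nat.gcd d' n with hA
  set g := Nat.gcd (m * d') n with hg
  set B := Nat.lcm (m * d') n / Nat.lcm d' n with hB
  have hApos : 0 < A := Nat.gcd_pos_of_pos_left _ hd'
  have hL : 0 < Nat.lcm d' n := Nat.lcm_pos hd' hn
  have hBL : B * Nat.lcm d' n = Nat.lcm (m * d') n :=
    Nat.div_mul_cancel (lcm_dvd_lcm (Nat.dvd_mul_left _ _) dvd_rfl)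
  have h1 : A * Nat.lcm d' n = d' * n := Nat.gcd_mul_lcm _ _
  have h2 : g * Nat.lcm (m * d') n = m * d' * n := Nat.gcd_mul_lcm _ _
  have hBg : g * B = m * A := by
    apply Nat.eq_of_mul_eq_mul_right hL
    rw [mul_assoc, hBL, h2, mul_assoc m A, h1, mul_assoc]
  have hu : upsilon n d' (m * d') * Nat.gcd A B = A := Nat.div_mul_cancel (Nat.gcd_dvd_left _ _)
  have h3 : g * Nat.gcd A B = Nat.gcd g m * A := by
    rw [← Nat.gcd_mul_left, hBg, Nat.gcd_mul_right g A m]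
  have h4 : upsilon n d' (m * d') * Nat.gcd g m = g := by
    apply Nat.eq_of_mul_eq_mul_right hApos
    rw [mul_assoc, ← h3, mul_left_comm, hu]
  calc g = upsilon n d' (m * d') * Nat.gcd g m := h4.symm
    _ ∣ _ := Nat.mul_dvd_mul_left _ (Nat.gcd_dvd_right _ _)

/-- If `u ∣ n`, the elements of `ℤ/nℤ` killed by `u` lie in the image of `ℤ/uℤ`. -/
theorem exists_zmod_hom_of_dvd {u n : ℕ} (hn : 0 < n) (hu : u ∣ n) :
    ∃ f : ZMod u →+ ZMod n, ∀ x : ZMod n, u • x = 0 → ∃ y, f y = x := by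
  have : NeZero n := ⟨hn.ne'⟩
  obtain ⟨k, rfl⟩ := hu
  have hupos : 0 < u := Nat.pos_of_mul_pos_right hn
  refine ⟨ZMod.lift u ⟨zmultiplesHom _ (k : ZMod (u * k)), ?_⟩, fun x hx => ?_⟩
  · rw [zmultiplesHom_apply, natCast_zsmul, nsmul_eq_mul, ← Nat.cast_mul, ZMod.natCast_self]
  · rw [← ZMod.natCast_zmod_val x, nsmul_eq_mul, ← Nat.cast_mul,
      ZMod.natCast_eq_zero_iff] at hx
    obtain ⟨z, hz⟩ := Nat.dvd_of_mul_dvd_mul_left hupos hx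
    refine ⟨((z : ℤ) : ZMod u), ?_⟩
    rw [ZMod.lift_coe, zmultiplesHom_apply, natCast_zsmul, nsmul_eq_mul, ← Nat.cast_mul,
      mul_comm z k, ← hz, ZMod.natCast_zmod_val]

/-- The subgroup `m • G_{md'}` lies in the image of `G_{υ(d', md')}`. -/
theorem exists_upsilon_hom {ι : Type*} {n : ι → ℕ} (hn : ∀ i, 0 < n i) {d d' m : ℕ}
    (hd : d = m * d') (hd' : 0 < d') :
    ∃ f : (∀ i, ZMod (upsilon (n i) d' d)) →+ (∀ i, ZMod (n i)),
      ∀ x, d • x = 0 → ∃ y, f y = m • x := by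
  subst hd
  choose f hf using fun i => exists_zmod_hom_of_dvd (hn i)
    ((upsilon_dvd_gcd (n i) d' (m * d')).trans (Nat.gcd_dvd_right _ _))
  refine ⟨AddMonoidHom.piMap f, fun x hx => ?_⟩
  have hx' : ∀ i, upsilon (n i) d' (m * d') • (m • x i) = 0 := by
    intro i
    have h1 : addOrderOf (x i) ∣ m * d' := addOrderOf_dvd_of_nsmul_eq_zero (congrFun hx i)
    have h2 : addOrderOf (x i) ∣ n i := addOrderOf_dvd_of_nsmul_eq_zero (by simp)
    rw [← mul_nsmul']
    exact addOrderOf_dvd_iff_nsmul_eq_zero.1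
      ((Nat.dvd_gcd h1 h2).trans (gcd_dvd_upsilon_mul (hn i) hd'))
  choose y hy using fun i => hf i (m • x i) (hx' i)
  exact ⟨y, funext hy⟩

theorem Multiset.exists_le_of_le_map {α β : Type*} (f : α → β) {s : Multiset α}
    {t : Multiset β} (h : t ≤ s.map f) : ∃ u ≤ s, u.map f = t := by
  induction s using Multiset.induction_on generalizing t with
  | empty => exact ⟨0, le_rfl, by simpa using (Multiset.le_zero.1 (by simpa using h)).symm⟩
  | cons a s ih =>
    rw [Multiset.map_cons] at h
    by_cases hmem : f a ∈ t
    · obtain ⟨t', rfl⟩ := Multiset.exists_cons_of_mem hmem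
      obtain ⟨u, hu, rfl⟩ := ih ((Multiset.cons_le_cons_iff _).1 h)
      exact ⟨a ::ₘ u, Multiset.cons_le_cons _ hu, Multiset.map_cons _ _ _⟩
    · obtain ⟨u, hu, rfl⟩ := ih ((Multiset.le_cons_of_notMem hmem).1 h)
      exact ⟨u, hu.trans (Multiset.le_cons_self _ _), rfl⟩

/-- Lift a sequence over `m`-multiples along `f` so that zero-sum subsequences descend. -/
theorem exists_lift_sequence {G H : Type*} [AddCommGroup G] [AddCommGroup H] (f : H →+ G) (m : ℕ)
    (S : Multiset G) (h : ∀ x ∈ S, ∃ y, f y = m • x) :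
    ∃ S' : Multiset H, Multiset.card S' = Multiset.card S ∧
      ∀ T' ≤ S', T'.sum = 0 → ∃ T ≤ S, Multiset.card T = Multiset.card T' ∧ m • T.sum = 0 := by
  choose! φ hφ using h
  refine ⟨S.map φ, Multiset.card_map _ _, fun T' hT' hsum => ?_⟩
  obtain ⟨T, hT, rfl⟩ := Multiset.exists_le_of_le_map φ hT'
  refine ⟨T, hT, (Multiset.card_map _ _).symm, ?_⟩
  have hf := congrArg f hsum
  rw [map_multiset_sum, map_zero, Multiset.map_map] at hf
  rw [← nsmulAddMonoidHom_apply, map_multiset_sum, ← hf]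
  exact congrArg _ (Multiset.map_congr rfl fun x hx => (hφ x (Multiset.mem_of_le hT hx)).symm)

theorem Multiset.exists_eq_sum_replicate_of_le {ι α : Type*} (s : Finset ι) (m : ι → ℕ)
    (f : ι → α) {T : Multiset α} (h : T ≤ ∑ j ∈ s, Multiset.replicate (m j) (f j)) :
    ∃ c : ι → ℕ, (∀ j ∈ s, c j ≤ m j) ∧ T = ∑ j ∈ s, Multiset.replicate (c j) (f j) := by
  induction s using Finset.induction_on generalizing T with
  | empty => exact ⟨0, by simp, by simpa using h⟩
  | insert a s ha ih =>
    rw [Finset.sum_insert ha] at h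
    obtain ⟨c, hc, hT⟩ := ih (T := T - Multiset.replicate (m a) (f a))
      (tsub_le_iff_left.2 h)
    obtain ⟨k, hk, hk'⟩ := Multiset.le_replicate_iff.1
      (Multiset.inter_le_right : T ∩ Multiset.replicate (m a) (f a) ≤ _)
    have hne : ∀ j ∈ s, j ≠ a := fun j hj h => ha (h ▸ hj)
    refine ⟨Function.update c a k, ?_, ?_⟩
    · intro j hj
      rcases Finset.mem_insert.1 hj with rfl | hj
      · simpa using hk
      · rw [Function.update_of_ne (hne j hj)]
        exact hc j hj
    · rw [Finset.sum_insert ha, Function.update_self, ← hk',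
        Finset.sum_congr rfl fun j hj => by rw [Function.update_of_ne (hne j hj)], ← hT,
        add_comm]
      exact (Multiset.sub_add_inter _ _).symm

theorem Nat.eq_zero_of_dvd_sum_ordCompl {n : ℕ} (hn : n ≠ 0) (c : ℕ → ℕ)
    (hc : ∀ p ∈ n.primeFactors, c p < p ^ n.factorization p)
    (h : n ∣ ∑ p ∈ n.primeFactors, c p * (n / p ^ n.factorization p)) :
    ∀ p ∈ n.primeFactors, c p = 0 := by
  intro p hp
  have hpp := Nat.prime_of_mem_primeFactors hp
  have hdvd : p ^ n.factorization p ∣ c p * (n / p ^ n.factorization p) := by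
    rw [← Finset.add_sum_erase _ _ hp] at h
    refine (Nat.dvd_add_left (Finset.dvd_sum fun q hq => ?_)).1 ((Nat.ordProj_dvd n p).trans h)
    obtain ⟨hqp, hq⟩ := Finset.mem_erase.1 hq
    have hqq := Nat.prime_of_mem_primeFactors hq
    refine Dvd.dvd.mul_left ?_ _
    have hcop : Nat.Coprime (p ^ n.factorization p) (q ^ n.factorization q) :=
      Nat.Coprime.pow _ _ ((Nat.coprime_primes hpp hqq).2 (Ne.symm hqp))
    refine hcop.dvd_of_dvd_mul_left ?_
    rw [Nat.ordProj_mul_ordCompl_eq_self]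
    exact Nat.ordProj_dvd n p
  exact Nat.eq_zero_of_dvd_of_lt
    (((Nat.coprime_ordCompl hpp hn).pow_left _).dvd_of_dvd_mul_right hdvd) (hc p hp)

theorem addOrderOf_single_ordCompl {ι : Type*} [DecidableEq ι] {n : ι → ℕ} {i : ι} (hi : n i ≠ 0) (p : ℕ) :
    addOrderOf (Pi.single i (((n i / p ^ (n i).factorization p : ℕ)) : ZMod (n i)) :
      ∀ i, ZMod (n i)) = p ^ (n i).factorization p := by
  have hinj : Function.Injective (AddMonoidHom.single (fun i => ZMod (n i)) i) :=
    Pi.single_injective (M := fun i => ZMod (n i)) i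
  have := addOrderOf_injective _ hinj
    ((n i / p ^ (n i).factorization p : ℕ) : ZMod (n i))
  rw [AddMonoidHom.single_apply] at this
  rw [this, ZMod.addOrderOf_coe _ hi,
    Nat.gcd_eq_right (Nat.div_dvd_of_dvd (Nat.ordProj_dvd _ _)),
    Nat.div_div_self (Nat.ordProj_dvd _ _) hi]

theorem kStarTuple_le_littleCrossNumber {r : ℕ} (n : Fin r → ℕ) (hn : ∀ i, 0 < n i) :
    kStarTuple n ≤ littleCrossNumber (∀ i, ZMod (n i)) := by
  have : ∀ i, NeZero (n i) := fun i => ⟨(hn i).ne'⟩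
  let I : Finset (Σ _ : Fin r, ℕ) := Finset.univ.sigma fun i => (n i).primeFactors
  let q : (Σ _ : Fin r, ℕ) → ℕ := fun j => j.2 ^ (n j.1).factorization j.2
  let e : (Σ _ : Fin r, ℕ) → ∀ i, ZMod (n i) := fun j =>
    Pi.single j.1 (((n j.1 / q j : ℕ)) : ZMod (n j.1))
  let S := ∑ j ∈ I, Multiset.replicate (q j - 1) (e j)
  have hq : ∀ j ∈ I, 0 < q j := fun j hj =>
    pow_pos (Nat.pos_of_mem_primeFactors (Finset.mem_sigma.1 hj).2) _
  have hS : IsZeroSumFree S := by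
    intro T hT hT0 hsum
    obtain ⟨c, hc, rfl⟩ := Multiset.exists_eq_sum_replicate_of_le I _ e hT
    refine hT0 (Finset.sum_eq_zero fun j hj => ?_)
    obtain ⟨i, p⟩ := j
    suffices h : c ⟨i, p⟩ = 0 by rw [h, Multiset.replicate_zero]
    refine Nat.eq_zero_of_dvd_sum_ordCompl (hn i).ne' (fun p => c ⟨i, p⟩) (fun p hp => ?_) ?_ p
      (Finset.mem_sigma.1 hj).2
    · have hmem : (⟨i, p⟩ : Σ _ : Fin r, ℕ) ∈ I := Finset.mem_sigma.2 ⟨Finset.mem_univ _, hp⟩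
      have := hc _ hmem
      have := hq _ hmem
      change c ⟨i, p⟩ < q ⟨i, p⟩
      omega
    · rw [← ZMod.natCast_eq_zero_iff, Nat.cast_sum]
      have h0 := congrFun hsum i
      rw [Multiset.sum_sum, Finset.sum_apply, Finset.sum_sigma, Finset.sum_eq_single i] at h0
      · simpa [e, q] using h0
      · intro i' _ hi'
        refine Finset.sum_eq_zero fun p _ => ?_
        simp [e, Pi.single_eq_of_ne (Ne.symm hi')]
      · simp
  convert hS.crossNumber_le using 1
  have hadd : crossNumber S = ∑ j ∈ I, crossNumber (Multiset.replicate (q j - 1) (e j)) := by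
    simp only [crossNumber, S]
    rw [← Multiset.coe_mapAddMonoidHom, map_sum, Multiset.sum_sum]
  rw [hadd, Finset.sum_sigma, kStarTuple]
  refine Finset.sum_congr rfl fun i _ => Finset.sum_congr rfl fun p hp => ?_
  have hpos := hq ⟨i, p⟩ (Finset.mem_sigma.2 ⟨Finset.mem_univ _, hp⟩)
  have hord : addOrderOf (e ⟨i, p⟩) = q ⟨i, p⟩ := addOrderOf_single_ordCompl (hn i).ne' p
  rw [crossNumber, Multiset.map_replicate, Multiset.sum_replicate, hord, nsmul_eq_mul,
    Nat.cast_sub hpos]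
  simp only [q]
  push_cast
  ring

theorem exponent_pi_zmod_dvd {ι : Type*} (u : ι → ℕ) {e : ℕ} (h : ∀ i, u i ∣ e) :
    AddMonoid.exponent (∀ i, ZMod (u i)) ∣ e := by
  refine AddMonoid.exponent_dvd_of_forall_nsmul_eq_zero fun x => funext fun i => ?_
  rw [Pi.smul_apply, nsmul_eq_mul, (ZMod.natCast_eq_zero_iff _ _).2 (h i), zero_mul, Pi.zero_apply]

/-- In a zero-sumfree sequence of maximal cross number and then minimal length, no nonempty
subsequence of at most `k` elements of order `m * k` has its sum killed by `m`. -/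
theorem nsmul_sum_ne_zero_of_minimal {G : Type*} [AddCommGroup G] [Finite G] {S : Multiset G}
    (hS : IsZeroSumFree S) (hmax : crossNumber S = littleCrossNumber G)
    (hmin : ∀ S' : Multiset G, IsZeroSumFree S' → crossNumber S' = littleCrossNumber G →
      Multiset.card S ≤ Multiset.card S')
    {m k : ℕ} (hm : 0 < m) (hk : 1 < k) {T : Multiset G} (hT : T ≤ S) (hT0 : T ≠ 0)
    (hord : ∀ x ∈ T, addOrderOf x = m * k) (hcard : Multiset.card T ≤ k) : m • T.sum ≠ 0 := by
  intro hsum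
  have hk0 : (0 : ℝ) < k := by exact_mod_cast (by omega : 0 < k)
  have hm0 : (0 : ℝ) < m := by exact_mod_cast hm
  have hzsf := hS.sum_cons_sub hT hT0
  have hle := hzsf.crossNumber_le
  have hsplit : crossNumber S = crossNumber T + crossNumber (S - T) := by
    conv_lhs => rw [← add_tsub_cancel_of_le hT]
    simp only [crossNumber, Multiset.map_add, Multiset.sum_add]
  have hTk : crossNumber T ≤ 1 / m := by
    have : crossNumber T = Multiset.card T * (1 / (m * k : ℝ)) := by
      rw [crossNumber, Multiset.map_congr rfl fun x hx => by rw [hord x hx], Multiset.map_const',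
        Multiset.sum_replicate, nsmul_eq_mul]
      push_cast
      rfl
    rw [this]
    calc (Multiset.card T : ℝ) * (1 / (m * k)) ≤ k * (1 / (m * k)) := by gcongr
      _ = 1 / m := by field_simp
  have hordsum : (1 : ℝ) / m ≤ 1 / addOrderOf T.sum := by
    have h0 : (0 : ℝ) < addOrderOf T.sum := by exact_mod_cast addOrderOf_pos T.sum
    gcongr
    exact Nat.le_of_dvd hm (addOrderOf_dvd_of_nsmul_eq_zero hsum)
  have hcons : crossNumber (T.sum ::ₘ (S - T)) = 1 / addOrderOf T.sum + crossNumber (S - T) := by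
    simp [crossNumber]
  have hlen := hmin _ hzsf (le_antisymm hle (by linarith))
  rw [Multiset.card_cons, Multiset.card_sub hT] at hlen
  have hTS := Multiset.card_le_card hT
  have hTpos := Multiset.card_pos.2 hT0
  obtain ⟨x, rfl⟩ := Multiset.card_eq_one.1 (by omega : Multiset.card T = 1)
  rw [Multiset.sum_singleton] at hsum
  have hdvd := addOrderOf_dvd_of_nsmul_eq_zero hsum
  rw [hord x (Multiset.mem_singleton_self x)] at hdvd
  have := Nat.le_of_dvd hm hdvd
  nlinarith

theorem stmt0 (r : ℕ) (hr : 0 < r) (n : Fin r → ℕ)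
    (hn : ∀ i, 1 < n i) (hdvd : ∀ i j : Fin r, i ≤ j → n i ∣ n j)
    (N : ℕ) (hN : N = n ⟨r - 1, by omega⟩)
    (S : Multiset (∀ i : Fin r, ZMod (n i)))
    (hSzsf : IsZeroSumFree S)
    (hSmax : crossNumber S = littleCrossNumber (∀ i : Fin r, ZMod (n i)))
    (hSmin : ∀ S' : Multiset (∀ i : Fin r, ZMod (n i)), IsZeroSumFree S' →
      crossNumber S' = littleCrossNumber (∀ i : Fin r, ZMod (n i)) →
      Multiset.card S ≤ Multiset.card S') :
    (∀ d ∈ N.divisors, ∀ d' ∈ d.divisors, 1 < d' →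
      Multiset.card (S.filter fun g => addOrderOf g = d) ≤
        etaConst (∀ i : Fin r, ZMod (upsilon (n i) d' d)) - 1) ∧
    (∀ d ∈ N.divisors,
      ∑ d' ∈ d.divisors, Multiset.card (S.filter fun g => addOrderOf g = d') ≤
        davenport (∀ i : Fin r, ZMod (upsilon (n i) d d)) - 1) ∧
    kStarTuple n ≤
      ∑ d ∈ N.divisors, (Multiset.card (S.filter fun g => addOrderOf g = d) : ℝ) / d := by
  have hn0 : ∀ i, 0 < n i := fun i => (Nat.zero_lt_one).trans (hn i)
  have : ∀ i, NeZero (n i) := fun i => ⟨(hn0 i).ne'⟩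
  have hN0 : N ≠ 0 := by
    rw [hN]
    exact (hn0 _).ne'
  have hpos : ∀ d ∈ N.divisors, 0 < d := fun d hd => Nat.pos_of_mem_divisors hd
  have hupos : ∀ d' d, 0 < d' → ∀ i, NeZero (upsilon (n i) d' d) := fun d' d hd' i =>
    ⟨(Nat.pos_of_dvd_of_pos (upsilon_dvd_gcd (n i) d' d) (Nat.gcd_pos_of_pos_left _ hd')).ne'⟩
  refine ⟨fun d hd d' hd' hd'1 => ?_, fun d hd => ?_, ?_⟩
  · obtain ⟨m, rfl⟩ := exists_eq_mul_left_of_dvd (Nat.dvd_of_mem_divisors hd')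
    have hm : 0 < m := Nat.pos_of_mul_pos_right (hpos _ hd)
    have hd'0 : 0 < d' := by omega
    have := hupos d' (m * d') hd'0
    refine Nat.le_sub_one_of_lt (not_le.1 fun hle => ?_)
    obtain ⟨f, hf⟩ := exists_upsilon_hom hn0 rfl hd'0
    obtain ⟨S', hcard, hS'⟩ := exists_lift_sequence f m
      (S.filter fun g => addOrderOf g = m * d') fun x hx => hf x (by
        rw [← (Multiset.mem_filter.1 hx).2]
        exact addOrderOf_nsmul_eq_zero x)
    obtain ⟨T', hT', hT'0, hT'card, hT'sum⟩ :=
      exists_short_zero_sum_of_etaConst_le S' (hcard ▸ hle)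
    obtain ⟨T, hT, hTcard, hTsum⟩ := hS' T' hT' hT'sum
    refine nsmul_sum_ne_zero_of_minimal hSzsf hSmax hSmin hm hd'1
      (hT.trans (Multiset.filter_le _ _)) ?_
      (fun x hx => (Multiset.mem_filter.1 (Multiset.mem_of_le hT hx)).2) ?_ hTsum
    · rwa [← Multiset.card_pos, hTcard, Multiset.card_pos]
    · rw [hTcard]
      exact hT'card.trans (Nat.le_of_dvd hd'0 (exponent_pi_zmod_dvd _ fun i =>
        (upsilon_dvd_gcd _ _ _).trans (Nat.gcd_dvd_left _ _)))
  · have hd0 := hpos d hd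
    have := hupos d d hd0
    rw [sum_card_filter_addOrderOf hd0.ne']
    refine Nat.le_sub_one_of_lt (not_le.1 fun hle => ?_)
    obtain ⟨f, hf⟩ := exists_upsilon_hom hn0 (one_mul d).symm hd0
    obtain ⟨S', hcard, hS'⟩ := exists_lift_sequence f 1
      (S.filter fun g => d • g = 0) fun x hx => hf x (Multiset.mem_filter.1 hx).2
    obtain ⟨T', hT', hT'0, hT'sum⟩ := exists_zero_sum_of_davenport_le S' (hcard ▸ hle)
    obtain ⟨T, hT, hTcard, hTsum⟩ := hS' T' hT' hT'sum
    refine hSzsf T (hT.trans (Multiset.filter_le _ _)) ?_ (by rwa [one_nsmul] at hTsum)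
    rwa [← Multiset.card_pos, hTcard, Multiset.card_pos]
  · have hexp : ∀ g : ∀ i, ZMod (n i), addOrderOf g ∣ N := fun g =>
      (AddMonoid.addOrder_dvd_exponent g).trans (exponent_pi_zmod_dvd n fun i => by
        rw [hN]
        exact hdvd _ _ (Fin.le_def.2 (by have := i.2; simp only; omega)))
    rw [← crossNumber_eq_sum_divisors hN0 hexp, hSmax]
    exact kStarTuple_le_littleCrossNumber n hn0
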